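/- arXiv:2311.06639 — 2 statements merged into one kernel-verified Lean document; each statement's English description precedes it below -/
import Mathlib

section
/- Let 0 < λ̲ ≤ λ̄ < ∞ and Λ > 0, and let Θ be the family of 2π-periodic, twice continuously differentiable radial functions r : ℝ → [λ̲, λ̄] with sup_θ (|r'(θ)| + |r''(θ)|) ≤ Λ. For r ∈ Θ let D_r := { s·p(θ) : θ ∈ [0,2π), 0 ≤ s < r(θ) } ⊂ ℝ² with p(θ) = (cos θ, sin θ), and for N ≥ 4 let D̃_{r,N} be the polygon with vertices r(2πi/N) p(2πi/N), i = 1,…,N. Let V : ℝ² → ℝ be continuously differentiable, ρ̃ := e^{−V}, f : ℝ² → [0,∞) continuous, κ > 0, and J(E) := ( ∫_E f ρ̃ dx + κ ∫_{∂E} ρ̃ dH^1 ) / ∫_E ρ̃ dx. Then there exists a constant C ≥ 0 such that for all N ≥ 4, | inf_{r ∈ Θ} J(D̃_{r,N}) − inf_{r ∈ Θ} J(D_r) | ≤ C/N. -/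
open MeasureTheory Real

/-- The unit vector `p(θ) = (cos θ, sin θ)` in the Euclidean plane. -/
noncomputable def pvec (θ : ℝ) : EuclideanSpace ℝ (Fin 2) :=
  (EuclideanSpace.equiv (Fin 2) ℝ).symm ![Real.cos θ, Real.sin θ]

/-- The star-shaped domain `D_r = {s·p(θ) : θ ∈ [0,2π), 0 ≤ s < r(θ)}`. -/
def starDomain (r : ℝ → ℝ) : Set (EuclideanSpace ℝ (Fin 2)) :=
  {x | ∃ θ ∈ Set.Ico (0 : ℝ) (2 * π), ∃ s ∈ Set.Ico (0 : ℝ) (r θ), x = s • pvec θ}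

/-- The vertex `p_i = r(2πi/N) p(2πi/N)` of the inscribed polygon. -/
noncomputable def starVertex (r : ℝ → ℝ) (N i : ℕ) : EuclideanSpace ℝ (Fin 2) :=
  r (2 * π * i / N) • pvec (2 * π * i / N)

/-- The inscribed star-shaped polygon `D̃_{r,N} = ⋃ᵢ conv{0, pᵢ, pᵢ₊₁}`. -/
noncomputable def starPolygon (r : ℝ → ℝ) (N : ℕ) : Set (EuclideanSpace ℝ (Fin 2)) :=
  ⋃ i ∈ Finset.range N, convexHull ℝ {0, starVertex r N i, starVertex r N (i + 1)}

/-- The shape functional `J(E) = (∫_E f e^{-V} dx + κ ∫_{∂E} e^{-V} dH¹)/∫_E e^{-V} dx`. -/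
noncomputable def shapeJ (V : EuclideanSpace ℝ (Fin 2) → ℝ)
    (f : EuclideanSpace ℝ (Fin 2) → ℝ) (κ : ℝ) (E : Set (EuclideanSpace ℝ (Fin 2))) : ℝ :=
  ((∫ x in E, f x * Real.exp (-V x)) +
      κ * ∫ x in frontier E, Real.exp (-V x) ∂(μH[(1 : ℝ)])) /
    ∫ x in E, Real.exp (-V x)

/-! ### Polar coordinates -/

/-- The Euclidean plane. -/
abbrev Plane := EuclideanSpace ℝ (Fin 2)

lemma pvec_apply_zero (θ : ℝ) : pvec θ 0 = Real.cos θ := by simp [pvec]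

lemma pvec_apply_one (θ : ℝ) : pvec θ 1 = Real.sin θ := by simp [pvec]

lemma norm_pvec (θ : ℝ) : ‖pvec θ‖ = 1 := by
  simp [EuclideanSpace.norm_eq, Fin.sum_univ_two, pvec_apply_zero, pvec_apply_one]

lemma norm_smul_pvec {s : ℝ} (hs : 0 ≤ s) (θ : ℝ) : ‖s • pvec θ‖ = s := by
  rw [norm_smul, norm_pvec, mul_one, Real.norm_of_nonneg hs]

lemma pvec_periodic : Function.Periodic pvec (2 * π) := fun θ => by
  ext i; fin_cases i <;> simp [pvec]

lemma hasDerivAt_pvec (θ : ℝ) : HasDerivAt pvec (pvec (θ + π / 2)) θ := by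
  refine (EuclideanSpace.equiv (Fin 2) ℝ).symm.hasFDerivAt.comp_hasDerivAt
    (f := fun θ => ![Real.cos θ, Real.sin θ]) (f' := ![Real.cos (θ + π / 2), Real.sin (θ + π / 2)])
    θ (hasDerivAt_pi.2 fun i => ?_)
  fin_cases i
  · simpa [Real.cos_add_pi_div_two] using Real.hasDerivAt_cos θ
  · simpa [Real.sin_add_pi_div_two] using Real.hasDerivAt_sin θ

lemma continuous_pvec : Continuous pvec :=
  continuous_iff_continuousAt.2 fun θ => (hasDerivAt_pvec θ).continuousAt

lemma exists_polar (x : Plane) : ∃ θ ∈ Set.Ico (0 : ℝ) (2 * π), x = ‖x‖ • pvec θ := by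
  obtain ⟨φ, hφ⟩ : ∃ φ : ℝ, x = ‖x‖ • pvec φ := by
    refine ⟨Complex.arg ⟨x 0, x 1⟩, ?_⟩
    have hn : ‖x‖ = ‖(⟨x 0, x 1⟩ : ℂ)‖ := by
      rw [EuclideanSpace.norm_eq, Fin.sum_univ_two, Complex.norm_eq_sqrt_sq_add_sq]
      simp
    ext i
    fin_cases i
    · simp [pvec, hn, Complex.norm_mul_cos_arg]
    · simp [pvec, hn, Complex.norm_mul_sin_arg]
  refine ⟨toIcoMod Real.two_pi_pos 0 φ, by simpa using toIcoMod_mem_Ico Real.two_pi_pos 0 φ, ?_⟩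
  rw [toIcoMod, pvec_periodic.sub_zsmul_eq]
  exact hφ

lemma polar_unique {s s' θ θ' : ℝ} (hs : 0 < s) (hs' : 0 ≤ s')
    (hθ : θ ∈ Set.Ico (0 : ℝ) (2 * π)) (hθ' : θ' ∈ Set.Ico (0 : ℝ) (2 * π))
    (h : s • pvec θ = s' • pvec θ') : s = s' ∧ θ = θ' := by
  have hss : s = s' := by
    simpa [norm_smul_pvec hs.le, norm_smul_pvec hs'] using congrArg norm h
  subst hss
  have hp : pvec θ = pvec θ' := smul_right_injective _ hs.ne' h
  have hc : Real.cos θ = Real.cos θ' := by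
    simpa [pvec_apply_zero] using congrArg (fun v : Plane => v 0) hp
  have hsn : Real.sin θ = Real.sin θ' := by
    simpa [pvec_apply_one] using congrArg (fun v : Plane => v 1) hp
  obtain ⟨k, hk⟩ := Real.Angle.angle_eq_iff_two_pi_dvd_sub.1 (Real.Angle.cos_sin_inj hc hsn)
  have hk1 : (k : ℝ) < 1 := by
    by_contra! hcon
    nlinarith [hθ.1, hθ.2, hθ'.1, hθ'.2, Real.pi_pos]
  have hk2 : (-1 : ℝ) < k := by
    by_contra! hcon
    nlinarith [hθ.1, hθ.2, hθ'.1, hθ'.2, Real.pi_pos]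
  have hk0 : k = 0 := by
    have h1 : k < 1 := by exact_mod_cast hk1
    have h2 : -1 < k := by exact_mod_cast hk2
    omega
  refine ⟨rfl, ?_⟩
  rw [hk0] at hk
  simp at hk
  linarith

/-! ### Star-shaped sets bounded by a compact curve -/

/-- The curve with radial function `R`. -/
def radialCurve (R : ℝ → ℝ) : Set Plane :=
  (fun θ => R θ • pvec θ) '' Set.Ico (0 : ℝ) (2 * π)

/-- The star-shaped set with radial function `R`, including its boundary curve. -/
def closedStar (R : ℝ → ℝ) : Set Plane :=
  {x | ∃ θ ∈ Set.Ico (0 : ℝ) (2 * π), ∃ s ∈ Set.Icc (0 : ℝ) (R θ), x = s • pvec θ}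

section Radial

variable {R : ℝ → ℝ} {m M : ℝ}

lemma starDomain_subset_closedStar : starDomain R ⊆ closedStar R := by
  rintro x ⟨θ, hθ, s, hs, rfl⟩
  exact ⟨θ, hθ, s, ⟨hs.1, hs.2.le⟩, rfl⟩

lemma mem_closedStar_diff (x : Plane) (hx : x ∈ closedStar R) (hx' : x ∉ starDomain R) :
    x ∈ radialCurve R := by
  obtain ⟨θ, hθ, s, hs, rfl⟩ := hx
  refine ⟨θ, hθ, ?_⟩
  rcases hs.2.lt_or_eq with h | h
  · exact absurd ⟨θ, hθ, s, ⟨hs.1, h⟩, rfl⟩ hx'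
  · simp [h]

lemma closedStar_eq_image (hm : 0 < m) (hR : ∀ θ ∈ Set.Ico (0 : ℝ) (2 * π), R θ ∈ Set.Icc m M) :
    closedStar R = (fun q : ℝ × Plane => q.1 • q.2) '' (Set.Icc (0 : ℝ) 1 ×ˢ radialCurve R) := by
  ext x
  constructor
  · rintro ⟨θ, hθ, s, hs, rfl⟩
    have hpos : 0 < R θ := hm.trans_le (hR θ hθ).1
    refine ⟨(s / R θ, R θ • pvec θ), ⟨⟨by have := hs.1; positivity, ?_⟩, θ, hθ, rfl⟩, ?_⟩
    · exact (div_le_one hpos).2 hs.2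
    · simp [smul_smul, div_mul_cancel₀ _ hpos.ne']
  · rintro ⟨⟨t, y⟩, ⟨ht, θ, hθ, rfl⟩, rfl⟩
    have hpos : 0 < R θ := hm.trans_le (hR θ hθ).1
    exact ⟨θ, hθ, t * R θ, ⟨mul_nonneg ht.1 hpos.le, by nlinarith [ht.2]⟩, by simp [smul_smul]⟩

lemma isCompact_closedStar (hm : 0 < m)
    (hR : ∀ θ ∈ Set.Ico (0 : ℝ) (2 * π), R θ ∈ Set.Icc m M) (hc : IsCompact (radialCurve R)) :
    IsCompact (closedStar R) := by
  rw [closedStar_eq_image hm hR]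
  exact (isCompact_Icc.prod hc).image (by fun_prop)

lemma isOpen_starDomain (hm : 0 < m)
    (hR : ∀ θ ∈ Set.Ico (0 : ℝ) (2 * π), R θ ∈ Set.Icc m M) (hc : IsCompact (radialCurve R)) :
    IsOpen (starDomain R) := by
  have key : starDomain R = Metric.ball 0 M \
      ((fun q : ℝ × Plane => q.1 • q.2) '' (Set.Icc (1 : ℝ) (M / m) ×ˢ radialCurve R)) := by
    ext x
    constructor
    · rintro ⟨θ, hθ, s, hs, rfl⟩
      have hpos : 0 < R θ := hm.trans_le (hR θ hθ).1
      refine ⟨?_, ?_⟩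
      · rw [mem_ball_zero_iff, norm_smul_pvec hs.1]
        exact hs.2.trans_le (hR θ hθ).2
      · rintro ⟨⟨t, y⟩, ⟨ht, θ', hθ', rfl⟩, h⟩
        have hpos' : 0 < R θ' := hm.trans_le (hR θ' hθ').1
        have ht1 : 1 ≤ t := ht.1
        simp only [smul_smul] at h
        obtain ⟨h1, rfl⟩ := polar_unique (by positivity) hs.1 hθ' hθ h
        nlinarith [hs.2]
    · rintro ⟨hx, hx'⟩
      obtain ⟨θ, hθ, hxθ⟩ := exists_polar x
      have hpos : 0 < R θ := hm.trans_le (hR θ hθ).1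
      refine ⟨θ, hθ, ‖x‖, ⟨norm_nonneg _, ?_⟩, hxθ⟩
      by_contra! hcon
      refine hx' ⟨(‖x‖ / R θ, R θ • pvec θ), ⟨⟨(one_le_div hpos).2 hcon, ?_⟩, θ, hθ, rfl⟩, ?_⟩
      · exact div_le_div₀ (hm.le.trans ((hR θ hθ).1.trans (hR θ hθ).2))
          (mem_ball_zero_iff.1 hx).le hm (hR θ hθ).1
      · simp only [smul_smul, div_mul_cancel₀ _ hpos.ne']
        exact hxθ.symm
  rw [key]
  exact Metric.isOpen_ball.sdiff ((isCompact_Icc.prod hc).image (by fun_prop)).isClosed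

lemma frontier_starDomain (hm : 0 < m)
    (hR : ∀ θ ∈ Set.Ico (0 : ℝ) (2 * π), R θ ∈ Set.Icc m M) (hc : IsCompact (radialCurve R)) :
    frontier (starDomain R) = radialCurve R := by
  rw [(isOpen_starDomain hm hR hc).frontier_eq]
  apply Set.Subset.antisymm
  · rintro x ⟨hx, hx'⟩
    exact mem_closedStar_diff x (closure_minimal starDomain_subset_closedStar
      (isCompact_closedStar hm hR hc).isClosed hx) hx'
  · rintro _ ⟨θ, hθ, rfl⟩
    have hpos : 0 < R θ := hm.trans_le (hR θ hθ).1
    constructor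
    · have hT : Filter.Tendsto (fun t : ℝ => t • (R θ • pvec θ)) (nhdsWithin 1 (Set.Iio 1))
          (nhds ((1 : ℝ) • (R θ • pvec θ))) :=
        (Continuous.tendsto (by fun_prop) 1).mono_left nhdsWithin_le_nhds
      rw [one_smul] at hT
      refine mem_closure_of_tendsto hT ?_
      filter_upwards [Ioo_mem_nhdsLT (show (0 : ℝ) < 1 by norm_num)] with t ht
      exact ⟨θ, hθ, t * R θ, ⟨(mul_pos ht.1 hpos).le, by nlinarith [ht.2]⟩, by simp [smul_smul]⟩
    · rintro ⟨θ', hθ', s, hs, h⟩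
      obtain ⟨h1, rfl⟩ := polar_unique hpos hs.1 hθ hθ' h
      exact hs.2.ne' h1

lemma frontier_closedStar (hm : 0 < m)
    (hR : ∀ θ ∈ Set.Ico (0 : ℝ) (2 * π), R θ ∈ Set.Icc m M) (hc : IsCompact (radialCurve R)) :
    frontier (closedStar R) = radialCurve R := by
  rw [(isCompact_closedStar hm hR hc).isClosed.frontier_eq]
  apply Set.Subset.antisymm
  · rintro x ⟨hx, hx'⟩
    exact mem_closedStar_diff x hx fun h => hx' <|
      interior_maximal starDomain_subset_closedStar (isOpen_starDomain hm hR hc) h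
  · rintro _ ⟨θ, hθ, rfl⟩
    have hpos : 0 < R θ := hm.trans_le (hR θ hθ).1
    refine ⟨⟨θ, hθ, R θ, ⟨hpos.le, le_rfl⟩, rfl⟩, ?_⟩
    rw [← Set.mem_compl_iff, ← closure_compl]
    have hT : Filter.Tendsto (fun t : ℝ => t • (R θ • pvec θ)) (nhdsWithin 1 (Set.Ioi 1))
        (nhds ((1 : ℝ) • (R θ • pvec θ))) :=
      (Continuous.tendsto (by fun_prop) 1).mono_left nhdsWithin_le_nhds
    rw [one_smul] at hT
    refine mem_closure_of_tendsto hT ?_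
    filter_upwards [self_mem_nhdsWithin] with t ht
    have ht1 : 1 < t := ht
    rintro ⟨θ', hθ', s, hs, h⟩
    rw [smul_smul] at h
    obtain ⟨h1, rfl⟩ := polar_unique (by positivity) hs.1 hθ hθ' h
    nlinarith [hs.2]

end Radial

/-! ### Decomposition of a radial curve into arcs -/

/-- The part of the curve with radial function `R` over the angles `[ih, (i+1)h)`. -/
def radialArc (R : ℝ → ℝ) (h : ℝ) (i : ℕ) : Set Plane :=
  (fun θ => R θ • pvec θ) '' Set.Ico (i * h) ((i + 1) * h)

lemma floor_div_eq {h θ : ℝ} {i : ℕ} (hh : 0 < h) (hθ : θ ∈ Set.Ico (i * h) ((i + 1) * h)) :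
    ⌊θ / h⌋₊ = i := by
  have h0 : 0 ≤ θ := le_trans (by positivity) hθ.1
  rw [Nat.floor_eq_iff (by positivity), le_div_iff₀ hh, div_lt_iff₀ hh]
  exact hθ

lemma Ico_subset_two_pi {N i : ℕ} (hi : i < N) :
    Set.Ico (i * (2 * π / N)) ((i + 1) * (2 * π / N)) ⊆ Set.Ico (0 : ℝ) (2 * π) := by
  have hN : (0 : ℝ) < N := by exact_mod_cast (Nat.zero_le i).trans_lt hi
  have hh : 0 < 2 * π / N := by positivity
  refine fun θ hθ => ⟨le_trans (by positivity) hθ.1, hθ.2.trans_le ?_⟩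
  have hiN : (i : ℝ) + 1 ≤ N := by exact_mod_cast hi
  calc ((i : ℝ) + 1) * (2 * π / N) ≤ N * (2 * π / N) := by gcongr
    _ = 2 * π := by field_simp

lemma radialCurve_eq_biUnion_arc (R : ℝ → ℝ) {N : ℕ} (hN : 0 < N) :
    radialCurve R = ⋃ i ∈ Finset.range N, radialArc R (2 * π / N) i := by
  have hN' : (0 : ℝ) < N := by exact_mod_cast hN
  have hh : 0 < 2 * π / N := by positivity
  apply Set.Subset.antisymm
  · rintro _ ⟨θ, hθ, rfl⟩
    have h0 : 0 ≤ θ / (2 * π / N) := div_nonneg hθ.1 hh.le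
    simp only [Set.mem_iUnion, Finset.mem_range]
    refine ⟨⌊θ / (2 * π / N)⌋₊, ?_, θ, ⟨?_, ?_⟩, rfl⟩
    · rw [Nat.floor_lt h0, div_lt_iff₀ hh]
      exact hθ.2.trans_eq (by field_simp)
    · rw [← le_div_iff₀ hh]
      exact Nat.floor_le h0
    · rw [← div_lt_iff₀ hh]
      exact Nat.lt_floor_add_one _
  · simp only [Set.iUnion_subset_iff, Finset.mem_range]
    exact fun i hi => Set.image_mono (Ico_subset_two_pi hi)

section Arcs

variable {R : ℝ → ℝ} {N : ℕ} {K : ℕ → Set Plane} {e : ℕ → Plane}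

lemma radialCurve_eq_biUnion (hN : 0 < N)
    (hK : ∀ i < N, insert (e i) (radialArc R (2 * π / N) i) = K i)
    (he : ∀ i < N, e i ∈ radialCurve R) :
    radialCurve R = ⋃ i ∈ Finset.range N, K i := by
  apply Set.Subset.antisymm
  · rw [radialCurve_eq_biUnion_arc R hN]
    refine Set.iUnion₂_mono fun i hi => ?_
    rw [← hK i (Finset.mem_range.1 hi)]
    exact Set.subset_insert _ _
  · refine Set.iUnion₂_subset fun i hi => ?_
    rw [← hK i (Finset.mem_range.1 hi)]
    refine Set.insert_subset (he i (Finset.mem_range.1 hi)) ?_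
    exact Set.image_mono (Ico_subset_two_pi (Finset.mem_range.1 hi))

lemma isCompact_radialCurve (hN : 0 < N)
    (hK : ∀ i < N, insert (e i) (radialArc R (2 * π / N) i) = K i)
    (he : ∀ i < N, e i ∈ radialCurve R) (hc : ∀ i < N, IsCompact (K i)) :
    IsCompact (radialCurve R) := by
  rw [radialCurve_eq_biUnion hN hK he]
  exact (Finset.range N).isCompact_biUnion fun i hi => hc i (Finset.mem_range.1 hi)

lemma setIntegral_radialCurve (hN : 0 < N) (hR : ∀ θ ∈ Set.Ico (0 : ℝ) (2 * π), 0 < R θ)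
    (hK : ∀ i < N, insert (e i) (radialArc R (2 * π / N) i) = K i)
    (hc : ∀ i < N, IsCompact (K i)) (hfin : ∀ i < N, μH[1] (K i) ≠ ⊤)
    {w : Plane → ℝ} (hw : Continuous w) :
    ∫ x in radialCurve R, w x ∂μH[1] = ∑ i ∈ Finset.range N, ∫ x in K i, w x ∂μH[1] := by
  have : NullSingletonClass (μH[1] : Measure Plane) :=
    Measure.nullSingletonClass_hausdorff Plane one_pos
  have hae : ∀ i < N, K i =ᵐ[μH[1]] radialArc R (2 * π / N) i := fun i hi => by
    rw [← hK i hi]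
    exact insert_ae_eq_self _ _
  rw [radialCurve_eq_biUnion_arc R hN, integral_biUnion_finset]
  · exact Finset.sum_congr rfl fun i hi =>
      setIntegral_congr_set (hae i (Finset.mem_range.1 hi)).symm
  · intro i hi
    have hi := Finset.mem_range.1 hi
    by_cases hmem : e i ∈ radialArc R (2 * π / N) i
    · rw [← Set.insert_eq_of_mem hmem, hK i hi]
      exact (hc i hi).measurableSet
    · rw [← Set.insert_sdiff_self_of_notMem hmem, hK i hi]
      exact (hc i hi).measurableSet.diff (measurableSet_singleton _)
  · have hN' : (0 : ℝ) < N := by exact_mod_cast hN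
    have hh : 0 < 2 * π / N := by positivity
    intro i hi j hj hij
    refine Set.disjoint_left.2 ?_
    rintro _ ⟨θ, hθ, rfl⟩ ⟨θ', hθ', h⟩
    have h1 := Ico_subset_two_pi (Finset.mem_range.1 hi) hθ
    have h2 := Ico_subset_two_pi (Finset.mem_range.1 hj) hθ'
    obtain ⟨-, rfl⟩ := polar_unique (hR _ h2) (hR _ h1).le h2 h1 h
    exact hij ((floor_div_eq hh hθ).symm.trans (floor_div_eq hh hθ'))
  · intro i hi
    have hi := Finset.mem_range.1 hi
    refine IntegrableOn.mono_set ?_ (hK i hi ▸ Set.subset_insert (e i) _)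
    exact hw.continuousOn.integrableOn_of_subset_isCompact (hc i hi) (hc i hi).measurableSet
      subset_rfl (hfin i hi)

end Arcs

/-! ### The radial function of the inscribed polygon -/

/-- The radial function, on the sector of angles `τ ∈ [0,h]`, of the segment joining the points
at distances `ρ` and `σ` on the two sides of the sector. -/
noncomputable def segRadius (h ρ σ τ : ℝ) : ℝ :=
  Real.sin h / (Real.sin (h - τ) / ρ + Real.sin τ / σ)

section Segment

variable {a h ρ σ τ : ℝ}

lemma segRadius_denom_pos (hh : 0 < h) (hh' : h ≤ π / 2) (hρ : 0 < ρ) (hσ : 0 < σ)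
    (hτ : τ ∈ Set.Icc 0 h) : 0 < Real.sin (h - τ) / ρ + Real.sin τ / σ := by
  have h1 : 0 ≤ Real.sin (h - τ) :=
    Real.sin_nonneg_of_nonneg_of_le_pi (by linarith [hτ.2]) (by linarith [hτ.1, Real.pi_pos])
  rcases hτ.1.eq_or_lt with rfl | h2
  · have h3 : 0 < Real.sin h := Real.sin_pos_of_pos_of_lt_pi hh (by linarith [Real.pi_pos])
    simp only [sub_zero, Real.sin_zero, zero_div, add_zero]
    positivity
  · have h3 : 0 < Real.sin τ :=
      Real.sin_pos_of_pos_of_lt_pi h2 (by linarith [Real.pi_pos, hτ.2])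
    positivity

lemma segRadius_smul_pvec (hh : 0 < h) (hh' : h ≤ π / 2) (hρ : 0 < ρ) (hσ : 0 < σ)
    (hτ : τ ∈ Set.Icc 0 h) :
    segRadius h ρ σ τ • pvec (a + τ) = AffineMap.lineMap (ρ • pvec a) (σ • pvec (a + h))
      (Real.sin τ / σ / (Real.sin (h - τ) / ρ + Real.sin τ / σ)) := by
  have hD := (segRadius_denom_pos hh hh' hρ hσ hτ).ne'
  rw [AffineMap.lineMap_apply_module, segRadius]
  set D := Real.sin (h - τ) / ρ + Real.sin τ / σ with hDdef
  have h1 : 1 - Real.sin τ / σ / D = Real.sin (h - τ) / ρ / D := by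
    rw [eq_div_iff hD, sub_mul, div_mul_cancel₀ _ hD, one_mul, hDdef]
    ring
  have h2 : Real.sin (h - τ) / ρ / D * ρ = Real.sin (h - τ) / D := by field_simp
  have h3 : Real.sin τ / σ / D * σ = Real.sin τ / D := by field_simp
  rw [h1, smul_smul, smul_smul, h2, h3]
  ext i
  fin_cases i
  · simp only [pvec, Fin.zero_eta, PiLp.smul_apply, PiLp.add_apply, smul_eq_mul,
      PiLp.continuousLinearEquiv_symm_apply, Matrix.cons_val_zero, Real.cos_add, Real.sin_sub]
    field_simp
    ring
  · simp only [pvec, Fin.mk_one, PiLp.smul_apply, PiLp.add_apply, smul_eq_mul,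
      PiLp.continuousLinearEquiv_symm_apply, Matrix.cons_val_one, Real.sin_add, Real.sin_sub]
    field_simp
    simp
    ring

lemma segRadius_image_Icc (hh : 0 < h) (hh' : h ≤ π / 2) (hρ : 0 < ρ) (hσ : 0 < σ) :
    (fun τ => segRadius h ρ σ τ • pvec (a + τ)) '' Set.Icc 0 h =
      segment ℝ (ρ • pvec a) (σ • pvec (a + h)) := by
  set g : ℝ → ℝ := fun τ => Real.sin τ / σ / (Real.sin (h - τ) / ρ + Real.sin τ / σ) with hg
  have hsin : 0 < Real.sin h := Real.sin_pos_of_pos_of_lt_pi hh (by linarith [Real.pi_pos])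
  have himg : g '' Set.Icc 0 h = Set.Icc 0 1 := by
    apply Set.Subset.antisymm
    · rintro _ ⟨τ, hτ, rfl⟩
      have h1 : 0 ≤ Real.sin (h - τ) := Real.sin_nonneg_of_nonneg_of_le_pi
        (by linarith [hτ.2]) (by linarith [hτ.1, Real.pi_pos])
      have h2 : 0 ≤ Real.sin τ := Real.sin_nonneg_of_nonneg_of_le_pi hτ.1
        (by linarith [hτ.2, Real.pi_pos])
      have hD := segRadius_denom_pos hh hh' hρ hσ hτ
      refine ⟨by positivity, (div_le_one hD).2 ?_⟩
      have : 0 ≤ Real.sin (h - τ) / ρ := by positivity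
      linarith
    · have hg0 : g 0 = 0 := by simp [hg]
      have hg1 : g h = 1 := by simp [hg, hsin.ne', hσ.ne']
      have hcont : ContinuousOn g (Set.Icc 0 h) :=
        ContinuousOn.div (by fun_prop) (by fun_prop)
          fun τ hτ => (segRadius_denom_pos hh hh' hρ hσ hτ).ne'
      have := intermediate_value_Icc hh.le hcont
      rwa [hg0, hg1] at this
  rw [segment_eq_image_lineMap, ← himg, Set.image_image]
  exact Set.image_congr fun τ hτ => segRadius_smul_pvec hh hh' hρ hσ hτ

lemma segRadius_left (hh : 0 < h) (hh' : h ≤ π / 2) : segRadius h ρ σ 0 = ρ := by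
  have hsin : 0 < Real.sin h := Real.sin_pos_of_pos_of_lt_pi hh (by linarith [Real.pi_pos])
  simp [segRadius, hsin.ne']

lemma segRadius_right (hh : 0 < h) (hh' : h ≤ π / 2) : segRadius h ρ σ h = σ := by
  have hsin : 0 < Real.sin h := Real.sin_pos_of_pos_of_lt_pi hh (by linarith [Real.pi_pos])
  simp [segRadius, hsin.ne']

lemma half_le_segRadius {m : ℝ} (hm : 0 < m) (hh : 0 < h) (hh' : h ≤ π / 2) (hρ : m ≤ ρ)
    (hσ : m ≤ σ) (hτ : τ ∈ Set.Icc 0 h) : m / 2 ≤ segRadius h ρ σ τ := by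
  have hD := segRadius_denom_pos hh hh' (hm.trans_le hρ) (hm.trans_le hσ) hτ
  have hsin : 0 < Real.sin h := Real.sin_pos_of_pos_of_lt_pi hh (by linarith [Real.pi_pos])
  have h1 : Real.sin (h - τ) ≤ Real.sin h :=
    Real.sin_le_sin_of_le_of_le_pi_div_two (by linarith [hτ.2, Real.pi_pos]) hh'
      (by linarith [hτ.1])
  have h2 : Real.sin τ ≤ Real.sin h :=
    Real.sin_le_sin_of_le_of_le_pi_div_two (by linarith [hτ.1, Real.pi_pos]) hh' hτ.2
  have h3 : Real.sin (h - τ) / ρ ≤ Real.sin h / m := div_le_div₀ hsin.le h1 hm hρ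
  have h4 : Real.sin τ / σ ≤ Real.sin h / m := div_le_div₀ hsin.le h2 hm hσ
  rw [segRadius, le_div_iff₀ hD]
  calc m / 2 * (Real.sin (h - τ) / ρ + Real.sin τ / σ)
      ≤ m / 2 * (Real.sin h / m + Real.sin h / m) := by gcongr
    _ = Real.sin h := by field_simp; ring

end Segment

/-- The radial function of the inscribed polygon `starPolygon r N`. -/
noncomputable def polyRadius (r : ℝ → ℝ) (N : ℕ) (θ : ℝ) : ℝ :=
  segRadius (2 * π / N) (r (⌊θ / (2 * π / N)⌋₊ * (2 * π / N)))
    (r ((⌊θ / (2 * π / N)⌋₊ + 1) * (2 * π / N))) (θ - ⌊θ / (2 * π / N)⌋₊ * (2 * π / N))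

lemma starVertex_eq (r : ℝ → ℝ) (N i : ℕ) :
    starVertex r N i = r (i * (2 * π / N)) • pvec (i * (2 * π / N)) := by
  rw [starVertex, show 2 * π * i / N = i * (2 * π / N) by ring]

lemma angle_step_le {N : ℕ} (hN : 4 ≤ N) : 0 < 2 * π / N ∧ 2 * π / N ≤ π / 2 := by
  have hN' : (4 : ℝ) ≤ N := by exact_mod_cast hN
  refine ⟨by positivity, ?_⟩
  rw [div_le_iff₀ (by linarith)]
  nlinarith [Real.pi_pos]

section Polygon

variable {r : ℝ → ℝ} {m M : ℝ} {N : ℕ}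

lemma starVertex_mem_radialCurve (hN : 4 ≤ N) (hper : Function.Periodic r (2 * π))
    {R : ℝ → ℝ} (hR : ∀ i < N, R (i * (2 * π / N)) = r (i * (2 * π / N))) {i : ℕ} (hi : i ≤ N) :
    starVertex r N i ∈ radialCurve R := by
  have hN0 : (N : ℝ) ≠ 0 := by
    have : 0 < N := by omega
    exact_mod_cast this.ne'
  have hh := (angle_step_le hN).1
  have key : ∀ j < N, starVertex r N j ∈ radialCurve R := fun j hj =>
    ⟨j * (2 * π / N), Ico_subset_two_pi hj ⟨le_rfl, by gcongr; linarith⟩, by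
      simp only [starVertex_eq, hR j hj]⟩
  rcases hi.lt_or_eq with hi | rfl
  · exact key i hi
  · have h0 : starVertex r i i = starVertex r i 0 := by
      have e1 : (i : ℝ) * (2 * π / i) = 0 + 2 * π := by field_simp; ring
      rw [starVertex_eq, starVertex_eq, e1, hper, pvec_periodic]
      simp
    rw [h0]
    exact key 0 (by omega)

lemma polyRadius_arc (hN : 4 ≤ N) (hr : ∀ θ, 0 < r θ) (i : ℕ) :
    insert (starVertex r N (i + 1)) (radialArc (polyRadius r N) (2 * π / N) i) =
      segment ℝ (starVertex r N i) (starVertex r N (i + 1)) := by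
  obtain ⟨hh, hh'⟩ := angle_step_le hN
  set h := 2 * π / N with hdef
  have harc : radialArc (polyRadius r N) h i =
      (fun τ => segRadius h (r (i * h)) (r ((i + 1) * h)) τ • pvec (i * h + τ)) ''
        Set.Ico 0 h := by
    have hIco : Set.Ico ((i : ℝ) * h) ((i + 1) * h) = (fun τ => i * h + τ) '' Set.Ico 0 h := by
      rw [Set.image_const_add_Ico]
      congr 1 <;> ring
    rw [radialArc, hIco, Set.image_image]
    refine Set.image_congr fun τ hτ => ?_
    have hmem : i * h + τ ∈ Set.Ico ((i : ℝ) * h) ((i + 1) * h) := by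
      rw [hIco]; exact Set.mem_image_of_mem _ hτ
    simp only [polyRadius, ← hdef, floor_div_eq hh hmem, add_sub_cancel_left]
  have hv : starVertex r N (i + 1) = r ((i + 1) * h) • pvec (i * h + h) := by
    rw [starVertex_eq, ← hdef]
    push_cast
    rw [show (i : ℝ) * h + h = (i + 1) * h by ring]
  rw [hv, starVertex_eq, ← hdef, ← segRadius_image_Icc hh hh' (hr _) (hr _),
    ← Set.Ico_insert_right hh.le, Set.image_insert_eq, harc, segRadius_right hh hh']

lemma polyRadius_vertex (hN : 4 ≤ N) (i : ℕ) :
    polyRadius r N (i * (2 * π / N)) = r (i * (2 * π / N)) := by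
  obtain ⟨hh, hh'⟩ := angle_step_le hN
  rw [polyRadius, floor_div_eq (i := i) hh ⟨le_rfl, by gcongr; linarith⟩, sub_self,
    segRadius_left hh hh']

lemma half_le_polyRadius (hN : 4 ≤ N) (hm : 0 < m) (hr : ∀ θ, m ≤ r θ) {θ : ℝ} (hθ : 0 ≤ θ) :
    m / 2 ≤ polyRadius r N θ := by
  obtain ⟨hh, hh'⟩ := angle_step_le hN
  refine half_le_segRadius hm hh hh' (hr _) (hr _) ⟨?_, ?_⟩
  · rw [sub_nonneg, ← le_div_iff₀ hh]
    exact Nat.floor_le (by positivity)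
  · have := Nat.lt_floor_add_one (θ / (2 * π / N))
    rw [div_lt_iff₀ hh] at this
    linarith

lemma norm_starVertex_le (hr : ∀ θ, r θ ∈ Set.Icc m M) (hm : 0 < m) (i : ℕ) :
    ‖starVertex r N i‖ ≤ M := by
  rw [starVertex_eq, norm_smul_pvec (hm.le.trans (hr _).1)]
  exact (hr _).2

lemma radialCurve_polyRadius (hN : 4 ≤ N) (hr : ∀ θ, 0 < r θ)
    (hper : Function.Periodic r (2 * π)) : radialCurve (polyRadius r N) =
      ⋃ i ∈ Finset.range N, segment ℝ (starVertex r N i) (starVertex r N (i + 1)) :=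
  radialCurve_eq_biUnion (by omega) (fun i _ => polyRadius_arc hN hr i) fun i hi =>
    starVertex_mem_radialCurve hN hper (fun j _ => polyRadius_vertex hN j) hi

lemma isCompact_segment (x y : Plane) : IsCompact (segment ℝ x y) := by
  rw [segment_eq_image_lineMap]
  exact isCompact_Icc.image (by fun_prop)

lemma isCompact_radialCurve_polyRadius (hN : 4 ≤ N) (hr : ∀ θ, 0 < r θ)
    (hper : Function.Periodic r (2 * π)) : IsCompact (radialCurve (polyRadius r N)) := by
  rw [radialCurve_polyRadius hN hr hper]
  exact (Finset.range N).isCompact_biUnion fun i _ => isCompact_segment _ _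

lemma polyRadius_mem_Icc (hN : 4 ≤ N) (hm : 0 < m) (hr : ∀ θ, r θ ∈ Set.Icc m M)
    (hper : Function.Periodic r (2 * π)) :
    ∀ θ ∈ Set.Ico (0 : ℝ) (2 * π), polyRadius r N θ ∈ Set.Icc (m / 2) M := by
  intro θ hθ
  have h1 := half_le_polyRadius hN hm (fun θ => (hr θ).1) hθ.1
  refine ⟨h1, ?_⟩
  have hmem : polyRadius r N θ • pvec θ ∈ radialCurve (polyRadius r N) := ⟨θ, hθ, rfl⟩
  rw [radialCurve_polyRadius hN (fun θ => hm.trans_le (hr θ).1) hper] at hmem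
  simp only [Set.mem_iUnion] at hmem
  obtain ⟨i, -, hi⟩ := hmem
  have := (convex_closedBall (0 : Plane) M).segment_subset
    (mem_closedBall_zero_iff.2 (norm_starVertex_le hr hm i))
    (mem_closedBall_zero_iff.2 (norm_starVertex_le hr hm (i + 1))) hi
  rwa [mem_closedBall_zero_iff, norm_smul_pvec (by linarith)] at this

lemma starPolygon_eq_closedStar (hN : 4 ≤ N) (hm : 0 < m) (hr : ∀ θ, r θ ∈ Set.Icc m M)
    (hper : Function.Periodic r (2 * π)) :
    starPolygon r N = closedStar (polyRadius r N) := by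
  rw [closedStar_eq_image (half_pos hm) (polyRadius_mem_Icc hN hm hr hper),
    radialCurve_polyRadius hN (fun θ => hm.trans_le (hr θ).1) hper, starPolygon]
  ext x
  simp only [Set.mem_iUnion, Set.mem_image, Set.mem_prod, Prod.exists,
    convexHull_insert (Set.insert_nonempty _ _), convexHull_pair, mem_convexJoin,
    Set.mem_singleton_iff, exists_eq_left]
  constructor
  · rintro ⟨i, hi, y, hy, hx⟩
    rw [segment_eq_image] at hx
    obtain ⟨t, ht, rfl⟩ := hx
    exact ⟨t, y, ⟨ht, i, hi, hy⟩, by simp⟩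
  · rintro ⟨t, y, ⟨ht, i, hi, hy⟩, rfl⟩
    refine ⟨i, hi, y, hy, ?_⟩
    rw [segment_eq_image]
    exact ⟨t, ht, by simp⟩

end Polygon

/-! ### Comparing an arc with its chord -/

section Chord

variable {c c' : ℝ → Plane} {K₁ K₂ a h : ℝ}

lemma curve_norm_sub_le (hc : ∀ θ, HasDerivAt c (c' θ) θ) (hK₁ : ∀ θ, ‖c' θ‖ ≤ K₁) (s t : ℝ) :
    ‖c s - c t‖ ≤ K₁ * |s - t| := by
  simpa using Convex.norm_image_sub_le_of_norm_hasDerivWithin_le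
    (fun θ _ => (hc θ).hasDerivWithinAt) (fun θ _ => hK₁ θ) convex_univ
    (Set.mem_univ t) (Set.mem_univ s)

lemma curve_norm_sub_sub_le (hc : ∀ θ, HasDerivAt c (c' θ) θ) (hK₂0 : 0 ≤ K₂)
    (hK₂ : ∀ s t, ‖c' s - c' t‖ ≤ K₂ * |s - t|) {s t : ℝ} (hs : s ∈ Set.Icc a (a + h))
    (ht : t ∈ Set.Icc a (a + h)) :
    ‖c s - c t - (s - t) • c' a‖ ≤ K₂ * h * |s - t| := by
  have hd : ∀ θ ∈ Set.Icc a (a + h), HasDerivWithinAt (fun θ => c θ - θ • c' a) (c' θ - c' a)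
      (Set.Icc a (a + h)) θ := fun θ _ => by
    have := (hc θ).sub ((hasDerivAt_id θ).smul_const (c' a))
    rw [one_smul] at this
    exact this.hasDerivWithinAt
  have hb : ∀ θ ∈ Set.Icc a (a + h), ‖c' θ - c' a‖ ≤ K₂ * h := fun θ hθ => by
    refine (hK₂ θ a).trans ?_
    gcongr
    rw [abs_of_nonneg (by linarith [hθ.1])]
    linarith [hθ.2]
  have := Convex.norm_image_sub_le_of_norm_hasDerivWithin_le hd hb (convex_Icc _ _) ht hs
  rwa [sub_sub_sub_comm, ← sub_smul] at this

lemma hausdorffMeasure_curve_le {K : ℝ} (hK : 0 ≤ K)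
    (hlip : ∀ s ∈ Set.Icc a (a + h), ∀ t ∈ Set.Icc a (a + h), ‖c s - c t‖ ≤ K * |s - t|) :
    μH[1] (c '' Set.Icc a (a + h)) ≤ ENNReal.ofReal (K * h) := by
  lift K to NNReal using hK
  have hL : LipschitzOnWith K c (Set.Icc a (a + h)) :=
    LipschitzOnWith.of_dist_le_mul fun s hs t ht => by
      simpa [dist_eq_norm, Real.dist_eq] using hlip s hs t ht
  have := hL.hausdorffMeasure_image_le zero_le_one
  rw [hausdorffMeasure_real, Real.volume_Icc, add_sub_cancel_left, ENNReal.rpow_one] at this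
  rwa [ENNReal.ofReal_mul K.coe_nonneg, ENNReal.ofReal_coe_nnreal]

lemma hausdorffMeasure_arc_le (hc : ∀ θ, HasDerivAt c (c' θ) θ) (hK₁0 : 0 ≤ K₁)
    (hK₁ : ∀ θ, ‖c' θ‖ ≤ K₁) :
    μH[1] (c '' Set.Icc a (a + h)) ≤ ENNReal.ofReal (K₁ * h) :=
  hausdorffMeasure_curve_le hK₁0 fun s _ t _ => curve_norm_sub_le hc hK₁ s t

lemma hausdorffMeasure_arc_le_chord (hh : 0 ≤ h) (hc : ∀ θ, HasDerivAt c (c' θ) θ) (hK₂0 : 0 ≤ K₂)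
    (hK₂ : ∀ s t, ‖c' s - c' t‖ ≤ K₂ * |s - t|) :
    μH[1] (c '' Set.Icc a (a + h)) ≤ ENNReal.ofReal (‖c (a + h) - c a‖ + 2 * K₂ * h ^ 2) := by
  have h1 : μH[1] (c '' Set.Icc a (a + h)) ≤ ENNReal.ofReal ((‖c' a‖ + K₂ * h) * h) := by
    refine hausdorffMeasure_curve_le (by positivity) fun s hs t ht => ?_
    have h2 := curve_norm_sub_sub_le hc hK₂0 hK₂ hs ht
    have h3 := norm_sub_norm_le (c s - c t) ((s - t) • c' a)
    rw [norm_smul, Real.norm_eq_abs] at h3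
    nlinarith
  refine h1.trans (ENNReal.ofReal_le_ofReal ?_)
  have h2 := curve_norm_sub_sub_le hc hK₂0 hK₂ (a := a) (h := h) (s := a + h) (t := a)
    ⟨by linarith, le_rfl⟩ ⟨le_rfl, by linarith⟩
  rw [add_sub_cancel_left, abs_of_nonneg hh, norm_sub_rev] at h2
  have h3 := norm_sub_norm_le (h • c' a) (c (a + h) - c a)
  rw [norm_smul, Real.norm_of_nonneg hh] at h3
  nlinarith

lemma chord_le_hausdorffMeasure_arc (hh : 0 ≤ h) (hc : Continuous c) :
    ENNReal.ofReal ‖c (a + h) - c a‖ ≤ μH[1] (c '' Set.Icc a (a + h)) := by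
  have hsub : Set.Icc 0 ‖c (a + h) - c a‖ ⊆
      (fun x => dist x (c a)) '' (c '' Set.Icc a (a + h)) := by
    rw [Set.image_image]
    have := intermediate_value_Icc (f := fun s => dist (c s) (c a)) (a := a) (b := a + h)
      (by linarith) (by fun_prop)
    simpa [dist_eq_norm] using this
  have hL : LipschitzWith 1 fun x : Plane => dist x (c a) := LipschitzWith.dist_left (c a)
  calc ENNReal.ofReal ‖c (a + h) - c a‖ = μH[1] (Set.Icc 0 ‖c (a + h) - c a‖) := by
        rw [hausdorffMeasure_real, Real.volume_Icc, sub_zero]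
    _ ≤ _ := measure_mono hsub
    _ ≤ _ := by simpa using hL.hausdorffMeasure_image_le zero_le_one (c '' Set.Icc a (a + h))

lemma abs_setIntegral_sub_const_mul_le {G : Set Plane} {w : Plane → ℝ} {v δ : ℝ}
    (hG : IsCompact G) (hfin : μH[1] G ≠ ⊤) (hw : Continuous w) (hδ : ∀ x ∈ G, |w x - v| ≤ δ) :
    |(∫ x in G, w x ∂μH[1]) - v * μH[1].real G| ≤ δ * μH[1].real G := by
  have hi : IntegrableOn w G μH[1] :=
    hw.continuousOn.integrableOn_of_subset_isCompact hG hG.measurableSet subset_rfl hfin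
  have h1 : (∫ x in G, w x ∂μH[1]) - v * μH[1].real G = ∫ x in G, (w x - v) ∂μH[1] := by
    rw [integral_sub hi (integrableOn_const hfin), setIntegral_const, smul_eq_mul, mul_comm]
  rw [h1, ← Real.norm_eq_abs]
  exact norm_setIntegral_le_of_norm_le_const hfin.lt_top hδ

lemma abs_integral_arc_sub_integral_chord_le {w : Plane → ℝ} {M L W : ℝ} (hh : 0 ≤ h)
    (hc : ∀ θ, HasDerivAt c (c' θ) θ) (hK₁0 : 0 ≤ K₁) (hK₁ : ∀ θ, ‖c' θ‖ ≤ K₁) (hK₂0 : 0 ≤ K₂)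
    (hK₂ : ∀ s t, ‖c' s - c' t‖ ≤ K₂ * |s - t|) (hM : ∀ θ, ‖c θ‖ ≤ M) (hL0 : 0 ≤ L)
    (hw : Continuous w) (hL : ∀ x y : Plane, ‖x‖ ≤ M → ‖y‖ ≤ M → |w x - w y| ≤ L * ‖x - y‖)
    (hW : ∀ x : Plane, ‖x‖ ≤ M → |w x| ≤ W) :
    |(∫ x in c '' Set.Icc a (a + h), w x ∂μH[1]) -
      ∫ x in segment ℝ (c a) (c (a + h)), w x ∂μH[1]| ≤
      (2 * L * K₁ ^ 2 + 2 * W * K₂) * h ^ 2 := by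
  have hcont : Continuous c := continuous_iff_continuousAt.2 fun θ => (hc θ).continuousAt
  set A := c '' Set.Icc a (a + h) with hA
  set S := segment ℝ (c a) (c (a + h)) with hS
  have hAub := hausdorffMeasure_arc_le (a := a) (h := h) hc hK₁0 hK₁
  have hAfin : μH[1] A ≠ ⊤ := (hAub.trans_lt ENNReal.ofReal_lt_top).ne
  have hSval : μH[1] S = ENNReal.ofReal ‖c (a + h) - c a‖ := by
    rw [hS, hausdorffMeasure_segment, edist_dist, dist_comm, dist_eq_norm]
  have hSfin : μH[1] S ≠ ⊤ := hSval ▸ ENNReal.ofReal_ne_top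
  have hSreal : μH[1].real S = ‖c (a + h) - c a‖ := by
    rw [measureReal_def, hSval, ENNReal.toReal_ofReal (norm_nonneg _)]
  have hchord : ‖c (a + h) - c a‖ ≤ K₁ * h := by
    have := curve_norm_sub_le hc hK₁ (a + h) a
    rwa [add_sub_cancel_left, abs_of_nonneg hh] at this
  have hA1 : μH[1].real A ≤ K₁ * h := ENNReal.toReal_le_of_le_ofReal (by positivity) hAub
  have hA2 : μH[1].real A ≤ ‖c (a + h) - c a‖ + 2 * K₂ * h ^ 2 :=
    ENNReal.toReal_le_of_le_ofReal (by positivity) (hausdorffMeasure_arc_le_chord hh hc hK₂0 hK₂)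
  have hA3 : ‖c (a + h) - c a‖ ≤ μH[1].real A :=
    (ENNReal.ofReal_le_iff_le_toReal hAfin).1 (chord_le_hausdorffMeasure_arc hh hcont)
  have hδA : ∀ x ∈ A, |w x - w (c a)| ≤ L * (K₁ * h) := by
    rintro _ ⟨s, hs, rfl⟩
    refine (hL _ _ (hM _) (hM _)).trans (mul_le_mul_of_nonneg_left ?_ hL0)
    refine (curve_norm_sub_le hc hK₁ s a).trans (mul_le_mul_of_nonneg_left ?_ hK₁0)
    rw [abs_of_nonneg (by linarith [hs.1])]
    linarith [hs.2]
  have hδS : ∀ x ∈ S, |w x - w (c a)| ≤ L * (K₁ * h) := by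
    intro x hx
    have hxM : ‖x‖ ≤ M := mem_closedBall_zero_iff.1 <|
      (convex_closedBall (0 : Plane) M).segment_subset (mem_closedBall_zero_iff.2 (hM _))
        (mem_closedBall_zero_iff.2 (hM _)) hx
    refine (hL _ _ hxM (hM _)).trans (mul_le_mul_of_nonneg_left ?_ hL0)
    refine le_trans ?_ hchord
    exact mem_closedBall_iff_norm.1 <| (convex_closedBall (c a) _).segment_subset
      (Metric.mem_closedBall_self (norm_nonneg _)) (mem_closedBall_iff_norm.2 le_rfl) hx
  have e1 := abs_setIntegral_sub_const_mul_le (isCompact_Icc.image hcont) hAfin hw hδA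
  have e2 := abs_setIntegral_sub_const_mul_le (isCompact_segment _ _) hSfin hw hδS
  have e3 : |w (c a) * (μH[1].real A - μH[1].real S)| ≤ W * (2 * K₂ * h ^ 2) := by
    rw [abs_mul]
    refine mul_le_mul (hW _ (hM _)) ?_ (abs_nonneg _) ((abs_nonneg _).trans (hW _ (hM a)))
    rw [hSreal, abs_of_nonneg (by linarith)]
    linarith
  have e4 : L * (K₁ * h) * μH[1].real A ≤ L * (K₁ * h) * (K₁ * h) := by gcongr
  have e5 : L * (K₁ * h) * μH[1].real S ≤ L * (K₁ * h) * (K₁ * h) := by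
    rw [hSreal]; gcongr
  rw [abs_le] at e1 e2 e3 ⊢
  constructor <;> nlinarith

end Chord

/-! ### The uniform class of radial functions -/

/-- The `C²` radial functions with values in `[m, M]` and derivatives bounded by `Λ`. -/
structure IsRadial (m M Λ : ℝ) (r : ℝ → ℝ) : Prop where
  contDiff : ContDiff ℝ 2 r
  periodic : Function.Periodic r (2 * π)
  mem_Icc : ∀ θ, r θ ∈ Set.Icc m M
  deriv_le : ∀ θ, |deriv r θ| + |deriv (deriv r) θ| ≤ Λ

/-- The velocity of the curve `θ ↦ r θ • pvec θ`. -/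
noncomputable def velocity (r : ℝ → ℝ) (θ : ℝ) : Plane :=
  deriv r θ • pvec θ + r θ • pvec (θ + π / 2)

namespace IsRadial

variable {m M Λ : ℝ} {r : ℝ → ℝ} {N : ℕ}

lemma pos (H : IsRadial m M Λ r) (hm : 0 < m) (θ : ℝ) : 0 < r θ := hm.trans_le (H.mem_Icc θ).1

lemma hasDerivAt (H : IsRadial m M Λ r) (θ : ℝ) : HasDerivAt r (deriv r θ) θ :=
  (H.contDiff.differentiable (by norm_num) θ).hasDerivAt

lemma hasDerivAt_deriv (H : IsRadial m M Λ r) (θ : ℝ) :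
    HasDerivAt (deriv r) (deriv (deriv r) θ) θ := by
  have h1 : ContDiff ℝ 1 (deriv r) :=
    ((contDiff_succ_iff_deriv (n := 1)).1 (by simpa [one_add_one_eq_two] using H.contDiff)).2.2
  exact (h1.differentiable (by norm_num) θ).hasDerivAt

lemma hasDerivAt_curve (H : IsRadial m M Λ r) (θ : ℝ) :
    HasDerivAt (fun θ => r θ • pvec θ) (velocity r θ) θ := by
  have := (H.hasDerivAt θ).smul (hasDerivAt_pvec θ)
  rwa [add_comm] at this

lemma abs_deriv_le (H : IsRadial m M Λ r) (θ : ℝ) : |deriv r θ| ≤ Λ := by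
  linarith [H.deriv_le θ, abs_nonneg (deriv (deriv r) θ)]

lemma abs_deriv_deriv_le (H : IsRadial m M Λ r) (θ : ℝ) : |deriv (deriv r) θ| ≤ Λ := by
  linarith [H.deriv_le θ, abs_nonneg (deriv r θ)]

lemma abs_radius_le (H : IsRadial m M Λ r) (hm : 0 < m) (θ : ℝ) : |r θ| ≤ M := by
  rw [abs_of_pos (H.pos hm θ)]
  exact (H.mem_Icc θ).2

lemma norm_curve_le (H : IsRadial m M Λ r) (hm : 0 < m) (θ : ℝ) : ‖r θ • pvec θ‖ ≤ M := by
  rw [norm_smul_pvec (H.pos hm θ).le]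
  exact (H.mem_Icc θ).2

lemma norm_velocity_le (H : IsRadial m M Λ r) (hm : 0 < m) (θ : ℝ) :
    ‖velocity r θ‖ ≤ Λ + M := by
  refine (norm_add_le _ _).trans ?_
  rw [norm_smul, norm_smul, norm_pvec, norm_pvec, mul_one, mul_one]
  exact add_le_add (H.abs_deriv_le θ) (H.abs_radius_le hm θ)

lemma norm_velocity_sub_le (H : IsRadial m M Λ r) (hm : 0 < m) (s t : ℝ) :
    ‖velocity r s - velocity r t‖ ≤ (3 * Λ + M) * |s - t| := by
  refine curve_norm_sub_le (c' := fun θ => (deriv r θ • pvec (θ + π / 2) +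
    deriv (deriv r) θ • pvec θ) + (r θ • pvec (θ + π / 2 + π / 2) +
      deriv r θ • pvec (θ + π / 2))) (fun θ => ?_) (fun θ => ?_) s t
  · exact ((H.hasDerivAt_deriv θ).smul (hasDerivAt_pvec θ)).add
      ((H.hasDerivAt θ).smul ((hasDerivAt_pvec (θ + π / 2)).comp_add_const θ (π / 2)))
  · refine (norm_add₃_le.trans (add_le_add_right (norm_add_le _ _) _)).trans ?_
    simp only [norm_smul, norm_pvec, mul_one, Real.norm_eq_abs]
    linarith [H.abs_deriv_le θ, H.abs_deriv_deriv_le θ, H.abs_radius_le hm θ]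

lemma radialArc_eq (r : ℝ → ℝ) (hN : 4 ≤ N) (i : ℕ) :
    insert (starVertex r N (i + 1)) (radialArc r (2 * π / N) i) =
      (fun θ => r θ • pvec θ) ''
        Set.Icc (i * (2 * π / N)) (i * (2 * π / N) + 2 * π / N) := by
  have hh := (angle_step_le hN).1
  have e : (i : ℝ) * (2 * π / N) + 2 * π / N = (i + 1) * (2 * π / N) := by ring
  rw [e, ← Set.Ico_insert_right (by nlinarith), Set.image_insert_eq, starVertex_eq, radialArc]
  push_cast
  rfl

lemma continuous_curve (H : IsRadial m M Λ r) : Continuous fun θ => r θ • pvec θ :=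
  H.contDiff.continuous.smul continuous_pvec

lemma isCompact_radialCurve (H : IsRadial m M Λ r) : IsCompact (radialCurve r) :=
  _root_.isCompact_radialCurve (N := 4) (by norm_num) (fun i _ => radialArc_eq r le_rfl i)
    (fun _ hi => starVertex_mem_radialCurve le_rfl H.periodic (fun _ _ => rfl) hi)
    fun _ _ => isCompact_Icc.image H.continuous_curve

lemma integral_frontier_starDomain (H : IsRadial m M Λ r) (hm : 0 < m) (hΛ : 0 ≤ Λ) (hM : 0 ≤ M)
    (hN : 4 ≤ N) {w : Plane → ℝ} (hw : Continuous w) :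
    ∫ x in frontier (starDomain r), w x ∂μH[1] = ∑ i ∈ Finset.range N,
      ∫ x in (fun θ => r θ • pvec θ) ''
        Set.Icc (i * (2 * π / N)) (i * (2 * π / N) + 2 * π / N), w x ∂μH[1] := by
  rw [frontier_starDomain hm (fun θ _ => H.mem_Icc θ) H.isCompact_radialCurve]
  exact setIntegral_radialCurve (by omega) (fun θ _ => H.pos hm θ) (fun i _ => radialArc_eq r hN i)
    (fun i _ => isCompact_Icc.image H.continuous_curve)
    (fun i _ => ((hausdorffMeasure_arc_le H.hasDerivAt_curve (add_nonneg hΛ hM)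
      (H.norm_velocity_le hm)).trans_lt ENNReal.ofReal_lt_top).ne) hw

lemma integral_frontier_starPolygon (H : IsRadial m M Λ r) (hm : 0 < m)
    (hN : 4 ≤ N) {w : Plane → ℝ} (hw : Continuous w) :
    ∫ x in frontier (starPolygon r N), w x ∂μH[1] = ∑ i ∈ Finset.range N,
      ∫ x in segment ℝ (starVertex r N i) (starVertex r N (i + 1)), w x ∂μH[1] := by
  rw [starPolygon_eq_closedStar hN hm H.mem_Icc H.periodic, frontier_closedStar (half_pos hm)
    (polyRadius_mem_Icc hN hm H.mem_Icc H.periodic)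
    (isCompact_radialCurve_polyRadius hN (H.pos hm) H.periodic)]
  refine setIntegral_radialCurve (by omega) (fun θ hθ => (half_pos hm).trans_le
    (half_le_polyRadius hN hm (fun θ => (H.mem_Icc θ).1) hθ.1))
    (fun i _ => polyRadius_arc hN (H.pos hm) i) (fun i _ => isCompact_segment _ _) (fun i _ => ?_) hw
  rw [hausdorffMeasure_segment]
  exact edist_ne_top _ _

lemma starVertex_succ (i : ℕ) : starVertex r N (i + 1) =
    r (i * (2 * π / N) + 2 * π / N) • pvec (i * (2 * π / N) + 2 * π / N) := by
  rw [starVertex_eq]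
  push_cast
  rw [add_one_mul]

lemma abs_integral_frontier_sub_le (H : IsRadial m M Λ r) (hm : 0 < m) (hΛ : 0 ≤ Λ) (hM : 0 ≤ M)
    (hN : 4 ≤ N) {w : Plane → ℝ} {L W : ℝ} (hL0 : 0 ≤ L) (hw : Continuous w)
    (hL : ∀ x y : Plane, ‖x‖ ≤ M → ‖y‖ ≤ M → |w x - w y| ≤ L * ‖x - y‖)
    (hW : ∀ x : Plane, ‖x‖ ≤ M → |w x| ≤ W) :
    |(∫ x in frontier (starPolygon r N), w x ∂μH[1]) -
      ∫ x in frontier (starDomain r), w x ∂μH[1]| ≤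
      (2 * L * (Λ + M) ^ 2 + 2 * W * (3 * Λ + M)) * (2 * π) ^ 2 * (1 / N) := by
  have hN' : (N : ℝ) ≠ 0 := by
    have : N ≠ 0 := by omega
    exact_mod_cast this
  rw [abs_sub_comm, H.integral_frontier_starDomain hm hΛ hM hN hw,
    H.integral_frontier_starPolygon hm hN hw, ← Finset.sum_sub_distrib]
  refine (Finset.abs_sum_le_sum_abs _ _).trans ?_
  have hterm : ∀ i ∈ Finset.range N, _ ≤ (2 * L * (Λ + M) ^ 2 + 2 * W * (3 * Λ + M)) *
      (2 * π / N) ^ 2 := fun i _ =>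
    abs_integral_arc_sub_integral_chord_le (a := i * (2 * π / N)) (angle_step_le hN).1.le
      H.hasDerivAt_curve (add_nonneg hΛ hM) (H.norm_velocity_le hm) (by positivity)
      (H.norm_velocity_sub_le hm) (H.norm_curve_le hm) hL0 hw hL hW
  simp only [starVertex_succ, starVertex_eq]
  refine (Finset.sum_le_sum hterm).trans_eq ?_
  rw [Finset.sum_const, Finset.card_range, nsmul_eq_mul]
  field_simp

lemma integral_frontier_starDomain_le (H : IsRadial m M Λ r) (hm : 0 < m) (hΛ : 0 ≤ Λ)
    (hM : 0 ≤ M) {w : Plane → ℝ} {W : ℝ} (hW0 : 0 ≤ W) (hw : Continuous w)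
    (hW : ∀ x : Plane, ‖x‖ ≤ M → |w x| ≤ W) :
    ∫ x in frontier (starDomain r), w x ∂μH[1] ≤ W * ((Λ + M) * (2 * π)) := by
  rw [H.integral_frontier_starDomain hm hΛ hM le_rfl hw]
  have hterm : ∀ i ∈ Finset.range 4, ∫ x in (fun θ => r θ • pvec θ) ''
      Set.Icc (i * (2 * π / (4 : ℕ))) (i * (2 * π / (4 : ℕ)) + 2 * π / (4 : ℕ)), w x ∂μH[1] ≤
      W * ((Λ + M) * (2 * π / (4 : ℕ))) := fun i _ => by
    have hub := hausdorffMeasure_arc_le (a := i * (2 * π / (4 : ℕ))) (h := 2 * π / (4 : ℕ))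
      H.hasDerivAt_curve (add_nonneg hΛ hM) (H.norm_velocity_le hm)
    have hint := norm_setIntegral_le_of_norm_le_const (f := w) (C := W)
      (hub.trans_lt ENNReal.ofReal_lt_top) (by
        rintro _ ⟨θ, -, rfl⟩
        exact hW _ (H.norm_curve_le hm θ))
    refine (le_abs_self _).trans (hint.trans ?_)
    gcongr
    exact ENNReal.toReal_le_of_le_ofReal (by positivity) hub
  refine (Finset.sum_le_sum hterm).trans_eq ?_
  rw [Finset.sum_const, Finset.card_range, nsmul_eq_mul]
  push_cast
  ring

end IsRadial

/-! ### Comparing the area integrals -/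

lemma abs_setIntegral_sub_le_of_sandwich {A D P : Set Plane} {g : Plane → ℝ} {F : ℝ}
    (hA : MeasurableSet A) (hAD : A ⊆ D) (hAP : A ⊆ P) (hg : IntegrableOn g (D ∪ P))
    (hfin : volume (D ∪ P) ≠ ⊤) (hg0 : ∀ x, 0 ≤ g x) (hF : ∀ x ∈ D ∪ P, g x ≤ F) :
    |(∫ x in P, g x) - ∫ x in D, g x| ≤ F * (volume.real (D ∪ P) - volume.real A) := by
  have hmono : ∀ {s t : Set Plane}, s ⊆ t → t ⊆ D ∪ P → ∫ x in s, g x ≤ ∫ x in t, g x :=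
    fun hst ht => setIntegral_mono_set (hg.mono_set ht) (Filter.Eventually.of_forall hg0)
      (Filter.Eventually.of_forall hst)
  have hU : A ⊆ D ∪ P := hAD.trans Set.subset_union_left
  have hdiff : (∫ x in D ∪ P, g x) - ∫ x in A, g x ≤
      F * (volume.real (D ∪ P) - volume.real A) := by
    rw [← setIntegral_sdiff hA hg hU, ← measureReal_sdiff hU hA hfin]
    have hbound := norm_setIntegral_le_of_norm_le_const (f := g) (C := F) (μ := volume)
      (s := (D ∪ P) \ A) ((measure_mono Set.sdiff_subset).trans_lt hfin.lt_top)
      fun x hx => (Real.norm_of_nonneg (hg0 x)).trans_le (hF x hx.1)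
    exact (le_abs_self _).trans hbound
  have h1 := hmono hAD Set.subset_union_left
  have h2 := hmono hAP Set.subset_union_right
  have h3 := hmono (s := D) Set.subset_union_left subset_rfl
  have h4 := hmono (s := P) Set.subset_union_right subset_rfl
  rw [abs_le]
  constructor <;> linarith

section Dilation

open scoped Pointwise

lemma volume_real_smul_set {t : ℝ} (s : Set Plane) :
    volume.real (t • s) = t ^ 2 * volume.real s := by
  rw [measureReal_def, Measure.addHaar_smul, ENNReal.toReal_mul, ← measureReal_def,
    finrank_euclideanSpace_fin, ENNReal.toReal_ofReal (abs_nonneg _), abs_of_nonneg (sq_nonneg t)]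

lemma sq_sub_inv_sq_le {ε : ℝ} (hε : 0 ≤ ε) :
    (1 + ε) ^ 2 - ((1 + ε)⁻¹) ^ 2 ≤ (4 + ε) * ε := by
  have h1 : 1 - ε ≤ (1 + ε)⁻¹ := by
    rw [← one_div, le_div_iff₀ (by linarith)]
    nlinarith
  have h2 : 1 - 2 * ε ≤ ((1 + ε)⁻¹) ^ 2 := by nlinarith [sq_nonneg ((1 + ε)⁻¹ - 1)]
  nlinarith

lemma starDomain_subset_ball {R : ℝ → ℝ} {M : ℝ} (hR : ∀ θ ∈ Set.Ico (0 : ℝ) (2 * π), R θ ≤ M) :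
    starDomain R ⊆ Metric.closedBall 0 M := by
  rintro x ⟨θ, hθ, s, hs, rfl⟩
  rw [mem_closedBall_zero_iff, norm_smul_pvec hs.1]
  exact hs.2.le.trans (hR θ hθ)

lemma closedStar_subset_ball {R : ℝ → ℝ} {M : ℝ} (hR : ∀ θ ∈ Set.Ico (0 : ℝ) (2 * π), R θ ≤ M) :
    closedStar R ⊆ Metric.closedBall 0 M := by
  rintro x ⟨θ, hθ, s, hs, rfl⟩
  rw [mem_closedBall_zero_iff, norm_smul_pvec hs.1]
  exact hs.2.trans (hR θ hθ)

lemma ball_subset_starDomain {R : ℝ → ℝ} {m : ℝ} (hR : ∀ θ ∈ Set.Ico (0 : ℝ) (2 * π), m ≤ R θ) :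
    Metric.ball 0 m ⊆ starDomain R := by
  intro x hx
  obtain ⟨θ, hθ, hxθ⟩ := exists_polar x
  exact ⟨θ, hθ, ‖x‖, ⟨norm_nonneg _, (mem_ball_zero_iff.1 hx).trans_le (hR θ hθ)⟩, hxθ⟩

lemma abs_setIntegral_star_sub_le {r R : ℝ → ℝ} {g : Plane → ℝ} {F M ε : ℝ} (hε : 0 ≤ ε)
    (h1 : ∀ θ ∈ Set.Ico (0 : ℝ) (2 * π), r θ ≤ (1 + ε) * R θ)
    (h2 : ∀ θ ∈ Set.Ico (0 : ℝ) (2 * π), R θ < (1 + ε) * r θ)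
    (hr0 : ∀ θ ∈ Set.Ico (0 : ℝ) (2 * π), 0 ≤ r θ)
    (hrM : ∀ θ ∈ Set.Ico (0 : ℝ) (2 * π), r θ ≤ M) (hRM : ∀ θ ∈ Set.Ico (0 : ℝ) (2 * π), R θ ≤ M)
    (hD : MeasurableSet (starDomain r)) (hg : Continuous g)
    (hg0 : ∀ x, 0 ≤ g x) (hF0 : 0 ≤ F) (hF : ∀ x : Plane, ‖x‖ ≤ M → g x ≤ F) :
    |(∫ x in closedStar R, g x) - ∫ x in starDomain r, g x| ≤
      F * ((4 + ε) * ε * volume.real (Metric.closedBall (0 : Plane) M)) := by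
  have hpos : 0 < 1 + ε := by linarith
  have hinv : (1 + ε)⁻¹ ≤ 1 := inv_le_one_of_one_le₀ (by linarith)
  have hball : starDomain r ∪ closedStar R ⊆ Metric.closedBall 0 M :=
    Set.union_subset (starDomain_subset_ball hrM) (closedStar_subset_ball hRM)
  have hballfin : volume (Metric.closedBall (0 : Plane) M) ≠ ⊤ := measure_closedBall_lt_top.ne
  have hsmall : (1 + ε)⁻¹ • starDomain r ⊆ starDomain r := by
    rintro _ ⟨_, ⟨θ, hθ, s, hs, rfl⟩, rfl⟩
    refine ⟨θ, hθ, (1 + ε)⁻¹ * s, ⟨mul_nonneg (by positivity) hs.1, ?_⟩, smul_smul _ _ _⟩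
    exact (mul_le_of_le_one_left hs.1 hinv).trans_lt hs.2
  have hsmall' : (1 + ε)⁻¹ • starDomain r ⊆ closedStar R := by
    rintro _ ⟨_, ⟨θ, hθ, s, hs, rfl⟩, rfl⟩
    refine ⟨θ, hθ, (1 + ε)⁻¹ * s, ⟨mul_nonneg (by positivity) hs.1, ?_⟩, smul_smul _ _ _⟩
    rw [inv_mul_le_iff₀ hpos]
    exact hs.2.le.trans (h1 θ hθ)
  have hlarge : starDomain r ∪ closedStar R ⊆ (1 + ε) • starDomain r := by
    have key : ∀ θ ∈ Set.Ico (0 : ℝ) (2 * π), ∀ s, 0 ≤ s → s < (1 + ε) * r θ →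
        s • pvec θ ∈ (1 + ε) • starDomain r := fun θ hθ s hs hs' =>
      ⟨((1 + ε)⁻¹ * s) • pvec θ, ⟨θ, hθ, (1 + ε)⁻¹ * s, ⟨by positivity, by
        rwa [inv_mul_lt_iff₀ hpos]⟩, rfl⟩, by
        simp only [smul_smul]
        rw [mul_inv_cancel_left₀ hpos.ne']⟩
    refine Set.union_subset ?_ ?_
    · rintro _ ⟨θ, hθ, s, hs, rfl⟩
      exact key θ hθ s hs.1 (by nlinarith [hs.2, hr0 θ hθ])
    · rintro _ ⟨θ, hθ, s, hs, rfl⟩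
      exact key θ hθ s hs.1 (hs.2.trans_lt (h2 θ hθ))
  have hDfin : volume (starDomain r) ≠ ⊤ :=
    ((measure_mono (starDomain_subset_ball hrM)).trans_lt hballfin.lt_top).ne
  refine (abs_setIntegral_sub_le_of_sandwich (hD.const_smul₀ _) hsmall hsmall'
    ((hg.continuousOn.integrableOn_compact (isCompact_closedBall _ _)).mono_set hball)
    ((measure_mono hball).trans_lt hballfin.lt_top).ne hg0
    fun x hx => hF x (mem_closedBall_zero_iff.1 (hball hx))).trans ?_
  gcongr
  have hle : volume.real (starDomain r ∪ closedStar R) ≤ (1 + ε) ^ 2 * volume.real (starDomain r) := by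
    rw [← volume_real_smul_set]
    refine measureReal_mono hlarge ?_
    rw [Measure.addHaar_smul]
    exact ENNReal.mul_ne_top ENNReal.ofReal_ne_top hDfin
  have hDle : volume.real (starDomain r) ≤ volume.real (Metric.closedBall (0 : Plane) M) :=
    measureReal_mono (starDomain_subset_ball hrM) hballfin
  calc volume.real (starDomain r ∪ closedStar R) - volume.real ((1 + ε)⁻¹ • starDomain r)
      ≤ ((1 + ε) ^ 2 - ((1 + ε)⁻¹) ^ 2) * volume.real (starDomain r) := by
        rw [volume_real_smul_set, sub_mul]; linarith
    _ ≤ (4 + ε) * ε * volume.real (Metric.closedBall (0 : Plane) M) :=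
        mul_le_mul (sq_sub_inv_sq_le hε) hDle measureReal_nonneg (by positivity)

end Dilation

lemma mul_volume_ball_le_setIntegral {E : Set Plane} {w : Plane → ℝ} {M ρ v : ℝ}
    (hE : MeasurableSet E) (hEM : E ⊆ Metric.closedBall 0 M) (hρ : Metric.ball 0 ρ ⊆ E)
    (hw : Continuous w) (hv0 : 0 ≤ v) (hv : ∀ x : Plane, ‖x‖ ≤ M → v ≤ w x) :
    v * volume.real (Metric.ball (0 : Plane) ρ) ≤ ∫ x in E, w x := by
  have hfin : volume E ≠ ⊤ := ((measure_mono hEM).trans_lt measure_closedBall_lt_top).ne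
  calc v * volume.real (Metric.ball (0 : Plane) ρ) ≤ v * volume.real E := by
        gcongr
    _ ≤ ∫ x in E, w x := setIntegral_ge_of_const_le_real hE hfin
        (fun x hx => hv x (mem_closedBall_zero_iff.1 (hEM hx)))
        ((hw.continuousOn.integrableOn_compact (isCompact_closedBall _ _)).mono_set hEM)

namespace IsRadial

variable {m M Λ : ℝ} {r : ℝ → ℝ} {N : ℕ}

lemma abs_sub_polyRadius_le (H : IsRadial m M Λ r) (hm : 0 < m) (hΛ : 0 ≤ Λ) (hM : 0 ≤ M)
    (hN : 4 ≤ N) {θ : ℝ} (hθ : θ ∈ Set.Ico (0 : ℝ) (2 * π)) :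
    |r θ - polyRadius r N θ| ≤ 2 * (Λ + M) * (2 * π / N) := by
  obtain ⟨hh, -⟩ := angle_step_le hN
  have hmem : r θ • pvec θ ∈ radialCurve r := ⟨θ, hθ, rfl⟩
  rw [radialCurve_eq_biUnion_arc r (show 0 < N by omega)] at hmem
  simp only [Set.mem_iUnion] at hmem
  obtain ⟨i, hi, θ', hθ', heq⟩ := hmem
  obtain ⟨-, rfl⟩ := polar_unique (H.pos hm θ') (H.pos hm θ).le
    (Ico_subset_two_pi (Finset.mem_range.1 hi) hθ') hθ heq
  have hlip := curve_norm_sub_le H.hasDerivAt_curve (H.norm_velocity_le hm)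
  have h1 : ‖r θ' • pvec θ' - starVertex r N i‖ ≤ (Λ + M) * (2 * π / N) := by
    rw [starVertex_eq]
    refine (hlip _ _).trans (mul_le_mul_of_nonneg_left ?_ (add_nonneg hΛ hM))
    rw [abs_of_nonneg (by linarith [hθ'.1])]
    linarith [hθ'.2]
  have h2 : ‖starVertex r N (i + 1) - starVertex r N i‖ ≤ (Λ + M) * (2 * π / N) := by
    rw [starVertex_succ, starVertex_eq]
    refine (hlip _ _).trans_eq ?_
    rw [add_sub_cancel_left, abs_of_pos hh]
  have h3 : ‖polyRadius r N θ' • pvec θ' - starVertex r N i‖ ≤ (Λ + M) * (2 * π / N) := by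
    have hseg : polyRadius r N θ' • pvec θ' ∈
        segment ℝ (starVertex r N i) (starVertex r N (i + 1)) := by
      rw [← polyRadius_arc hN (H.pos hm)]
      exact Set.mem_insert_of_mem _ ⟨θ', hθ', rfl⟩
    refine le_trans ?_ h2
    exact mem_closedBall_iff_norm.1 <| (convex_closedBall (starVertex r N i) _).segment_subset
      (Metric.mem_closedBall_self (norm_nonneg _)) (mem_closedBall_iff_norm.2 le_rfl) hseg
  have h4 : |r θ' - polyRadius r N θ'| = ‖r θ' • pvec θ' - polyRadius r N θ' • pvec θ'‖ := by
    rw [← sub_smul, norm_smul, norm_pvec, mul_one, Real.norm_eq_abs]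
  rw [h4]
  have h5 := norm_sub_le_norm_sub_add_norm_sub (r θ' • pvec θ') (starVertex r N i)
    (polyRadius r N θ' • pvec θ')
  rw [norm_sub_rev (starVertex r N i)] at h5
  linarith

lemma measurableSet_starDomain (H : IsRadial m M Λ r) (hm : 0 < m) :
    MeasurableSet (starDomain r) :=
  (isOpen_starDomain hm (fun θ _ => H.mem_Icc θ) H.isCompact_radialCurve).measurableSet

lemma measurableSet_starPolygon (H : IsRadial m M Λ r) (hm : 0 < m) (hN : 4 ≤ N) :
    MeasurableSet (starPolygon r N) := by
  rw [starPolygon_eq_closedStar hN hm H.mem_Icc H.periodic]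
  exact (isCompact_closedStar (half_pos hm) (polyRadius_mem_Icc hN hm H.mem_Icc H.periodic)
    (isCompact_radialCurve_polyRadius hN (H.pos hm) H.periodic)).measurableSet

lemma starPolygon_subset_ball (H : IsRadial m M Λ r) (hm : 0 < m) (hN : 4 ≤ N) :
    starPolygon r N ⊆ Metric.closedBall 0 M := by
  rw [starPolygon_eq_closedStar hN hm H.mem_Icc H.periodic]
  exact closedStar_subset_ball fun θ hθ =>
    (polyRadius_mem_Icc hN hm H.mem_Icc H.periodic θ hθ).2

lemma ball_subset_starPolygon (H : IsRadial m M Λ r) (hm : 0 < m) (hN : 4 ≤ N) :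
    Metric.ball 0 (m / 2) ⊆ starPolygon r N := by
  rw [starPolygon_eq_closedStar hN hm H.mem_Icc H.periodic]
  exact (ball_subset_starDomain fun θ hθ =>
    (polyRadius_mem_Icc hN hm H.mem_Icc H.periodic θ hθ).1).trans starDomain_subset_closedStar

lemma abs_integral_starPolygon_sub_le (H : IsRadial m M Λ r) (hm : 0 < m) (hΛ : 0 ≤ Λ)
    (hM : 0 ≤ M) (hN : 4 ≤ N) {g : Plane → ℝ} {F : ℝ} (hg : Continuous g) (hg0 : ∀ x, 0 ≤ g x)
    (hF0 : 0 ≤ F) (hF : ∀ x : Plane, ‖x‖ ≤ M → g x ≤ F) :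
    |(∫ x in starPolygon r N, g x) - ∫ x in starDomain r, g x| ≤
      F * ((4 + 4 * (Λ + M) * (π / 2) / m) * (4 * (Λ + M) * (2 * π) / m) *
        volume.real (Metric.closedBall (0 : Plane) M)) * (1 / N) := by
  obtain ⟨hh, hh'⟩ := angle_step_le hN
  rw [starPolygon_eq_closedStar hN hm H.mem_Icc H.periodic]
  set ε := 4 * (Λ + M) * (2 * π / N) / m with hεdef
  have hε : 0 ≤ ε := by positivity
  have hεm : ε * m = 4 * (Λ + M) * (2 * π / N) := by
    rw [hεdef]; field_simp
  have hpoly := polyRadius_mem_Icc hN hm H.mem_Icc H.periodic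
  refine (abs_setIntegral_star_sub_le (M := M) hε (fun θ hθ => ?_) (fun θ hθ => ?_)
    (fun θ _ => (H.pos hm θ).le) (fun θ _ => (H.mem_Icc θ).2) (fun θ hθ => (hpoly θ hθ).2)
    (H.measurableSet_starDomain hm) hg hg0 hF0 hF).trans ?_
  · have h1 := (abs_le.1 (H.abs_sub_polyRadius_le hm hΛ hM hN hθ)).2
    nlinarith [(hpoly θ hθ).1]
  · have h1 := (abs_le.1 (H.abs_sub_polyRadius_le hm hΛ hM hN hθ)).1
    rcases hε.eq_or_lt with h0 | h0
    · have hpos : 0 < 4 * (Λ + M) * (2 * π / N) := by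
        have := hm.trans_le ((H.mem_Icc 0).1.trans (H.mem_Icc 0).2)
        positivity
      rw [← hεm, ← h0] at hpos
      simp at hpos
    · nlinarith [(H.mem_Icc θ).1]
  · have hle : ε ≤ 4 * (Λ + M) * (π / 2) / m := by rw [hεdef]; gcongr
    have heq : ε = 4 * (Λ + M) * (2 * π) / m * (1 / N) := by rw [hεdef]; ring
    calc F * ((4 + ε) * ε * volume.real (Metric.closedBall (0 : Plane) M))
        ≤ F * ((4 + 4 * (Λ + M) * (π / 2) / m) * ε *
            volume.real (Metric.closedBall (0 : Plane) M)) := by gcongr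
      _ = _ := by rw [heq]; ring

end IsRadial

/-! ### Quotients and infima -/

lemma abs_div_sub_div_le {a a' b b' α β A b₀ t : ℝ} (ha : |a - a'| ≤ α * t)
    (hb : |b - b'| ≤ β * t) (hA : |a'| ≤ A) (hb₀ : 0 < b₀) (h : b₀ ≤ b) (h' : b₀ ≤ b') :
    |a / b - a' / b'| ≤ (α / b₀ + A * β / b₀ ^ 2) * t := by
  have hbp : 0 < b := hb₀.trans_le h
  have hbp' : 0 < b' := hb₀.trans_le h'
  have e : a / b - a' / b' = (a - a') / b - a' * (b - b') / (b * b') := by field_simp; ring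
  have hA0 : 0 ≤ A := (abs_nonneg _).trans hA
  have h1 : |(a - a') / b| ≤ α * t / b₀ := by
    rw [abs_div, abs_of_pos hbp]
    exact div_le_div₀ ((abs_nonneg _).trans ha) ha hb₀ h
  have h2 : |a' * (b - b') / (b * b')| ≤ A * (β * t) / b₀ ^ 2 := by
    rw [abs_div, abs_mul, abs_of_pos (mul_pos hbp hbp'), sq]
    have hβ : 0 ≤ β * t := (abs_nonneg _).trans hb
    exact div_le_div₀ (by positivity) (mul_le_mul hA hb (abs_nonneg _) hA0) (by positivity)
      (mul_le_mul h h' hb₀.le hbp.le)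
  rw [e]
  calc _ ≤ |(a - a') / b| + |a' * (b - b') / (b * b')| := abs_sub _ _
    _ ≤ α * t / b₀ + A * (β * t) / b₀ ^ 2 := add_le_add h1 h2
    _ = _ := by ring

lemma abs_sInf_image_sub_le {ι : Type*} {S : Set ι} (hS : S.Nonempty) {F G : ι → ℝ} {δ : ℝ}
    (hF : BddBelow (F '' S)) (hG : BddBelow (G '' S)) (h : ∀ x ∈ S, |F x - G x| ≤ δ) :
    |sInf (F '' S) - sInf (G '' S)| ≤ δ := by
  rw [abs_le]
  constructor
  · have : sInf (G '' S) - δ ≤ sInf (F '' S) := by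
      refine le_csInf (hS.image F) ?_
      rintro _ ⟨x, hx, rfl⟩
      linarith [csInf_le hG (Set.mem_image_of_mem G hx), (abs_le.1 (h x hx)).1]
    linarith
  · have : sInf (F '' S) - δ ≤ sInf (G '' S) := by
      refine le_csInf (hS.image G) ?_
      rintro _ ⟨x, hx, rfl⟩
      linarith [csInf_le hF (Set.mem_image_of_mem F hx), (abs_le.1 (h x hx)).2]
    linarith

lemma shapeJ_nonneg {V f : Plane → ℝ} {κ : ℝ} (hf0 : ∀ x, 0 ≤ f x) (hκ : 0 ≤ κ) (E : Set Plane) :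
    0 ≤ shapeJ V f κ E :=
  div_nonneg (add_nonneg (integral_nonneg fun x => mul_nonneg (hf0 x) (Real.exp_pos _).le)
    (mul_nonneg hκ (integral_nonneg fun _ => (Real.exp_pos _).le)))
    (integral_nonneg fun _ => (Real.exp_pos _).le)

/-- The shape functional of a domain in the class is approximated by that of the inscribed
polygon at rate `1/N`, uniformly over the class. -/
lemma exists_abs_shapeJ_sub_le {m M Λ : ℝ} (hm : 0 < m) (hmM : m ≤ M) (hΛ : 0 ≤ Λ)
    {V f : Plane → ℝ} (hV : ContDiff ℝ 1 V) (hf : Continuous f) (hf0 : ∀ x, 0 ≤ f x)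
    {κ : ℝ} (hκ : 0 ≤ κ) :
    ∃ C, ∀ r, IsRadial m M Λ r → ∀ N : ℕ, 4 ≤ N →
      |shapeJ V f κ (starPolygon r N) - shapeJ V f κ (starDomain r)| ≤ C * (1 / N) := by
  have hM : 0 ≤ M := hm.le.trans hmM
  set w : Plane → ℝ := fun x => Real.exp (-V x) with hwdef
  have hwC : ContDiff ℝ 1 w := hV.neg.exp
  have hw : Continuous w := hwC.continuous
  have hw0 : ∀ x, 0 < w x := fun x => Real.exp_pos _
  have hcpt : IsCompact (Metric.closedBall (0 : Plane) M) := isCompact_closedBall _ _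
  obtain ⟨L, hL⟩ := hwC.contDiffOn.exists_lipschitzOnWith one_ne_zero
    (convex_closedBall (0 : Plane) M) hcpt
  have hL' : ∀ x y : Plane, ‖x‖ ≤ M → ‖y‖ ≤ M → |w x - w y| ≤ L * ‖x - y‖ := fun x y hx hy => by
    simpa [Real.dist_eq, dist_eq_norm] using
      hL.dist_le_mul x (mem_closedBall_zero_iff.2 hx) y (mem_closedBall_zero_iff.2 hy)
  obtain ⟨W, hW⟩ := hcpt.exists_bound_of_continuousOn hw.continuousOn
  have hW' : ∀ x : Plane, ‖x‖ ≤ M → |w x| ≤ W := fun x hx => hW x (mem_closedBall_zero_iff.2 hx)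
  have hW0 : 0 ≤ W := (abs_nonneg _).trans (hW' 0 (by simpa using hM))
  have hg : Continuous fun x => f x * w x := hf.mul hw
  have hg0 : ∀ x, 0 ≤ f x * w x := fun x => mul_nonneg (hf0 x) (hw0 x).le
  obtain ⟨F, hF⟩ := hcpt.exists_bound_of_continuousOn hg.continuousOn
  have hF' : ∀ x : Plane, ‖x‖ ≤ M → f x * w x ≤ F := fun x hx =>
    (le_abs_self _).trans (hF x (mem_closedBall_zero_iff.2 hx))
  have hF0 : 0 ≤ F := (hg0 0).trans (hF' 0 (by simpa using hM))
  obtain ⟨x₀, -, hx₀⟩ := hcpt.exists_isMinOn ⟨0, by simpa using hM⟩ hw.continuousOn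
  have hv : ∀ x : Plane, ‖x‖ ≤ M → w x₀ ≤ w x := fun x hx =>
    hx₀ (mem_closedBall_zero_iff.2 hx)
  have hb₀ : 0 < w x₀ * volume.real (Metric.ball (0 : Plane) (m / 2)) :=
    mul_pos (hw0 _) (ENNReal.toReal_pos (Metric.measure_ball_pos _ _ (half_pos hm)).ne'
      measure_ball_lt_top.ne)
  set B := (4 + 4 * (Λ + M) * (π / 2) / m) * (4 * (Λ + M) * (2 * π) / m) *
    volume.real (Metric.closedBall (0 : Plane) M)
  set S := (2 * L * (Λ + M) ^ 2 + 2 * W * (3 * Λ + M)) * (2 * π) ^ 2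
  set A := F * volume.real (Metric.closedBall (0 : Plane) M) + κ * (W * ((Λ + M) * (2 * π)))
  set b₀ := w x₀ * volume.real (Metric.ball (0 : Plane) (m / 2))
  refine ⟨(F * B + κ * S) / b₀ + A * (W * B) / b₀ ^ 2, fun r H N hN => ?_⟩
  have hDM : starDomain r ⊆ Metric.closedBall 0 M :=
    starDomain_subset_ball fun θ _ => (H.mem_Icc θ).2
  have e1 := H.abs_integral_starPolygon_sub_le hm hΛ hM hN hg hg0 hF0 hF'
  have e2 := H.abs_integral_starPolygon_sub_le hm hΛ hM hN hw (fun x => (hw0 x).le) hW0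
    fun x hx => (le_abs_self _).trans (hW' x hx)
  have e3 := H.abs_integral_frontier_sub_le hm hΛ hM hN L.coe_nonneg hw hL' hW'
  have e4 := H.integral_frontier_starDomain_le hm hΛ hM hW0 hw hW'
  have e5 : ∫ x in starDomain r, f x * w x ≤
      F * volume.real (Metric.closedBall (0 : Plane) M) := by
    refine (le_abs_self _).trans ((norm_setIntegral_le_of_norm_le_const
      ((measure_mono hDM).trans_lt measure_closedBall_lt_top) fun x hx => hF x (hDM hx)).trans ?_)
    gcongr
    exact measure_closedBall_lt_top.ne
  have e6 : 0 ≤ ∫ x in starDomain r, f x * w x := integral_nonneg hg0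
  have e7 : 0 ≤ ∫ x in frontier (starDomain r), w x ∂μH[1] := integral_nonneg fun x => (hw0 x).le
  refine abs_div_sub_div_le ?_ e2 ?_ hb₀ ?_ ?_
  · rw [add_sub_add_comm, ← mul_sub]
    refine (abs_add_le _ _).trans ?_
    rw [abs_mul, abs_of_nonneg hκ, add_mul, mul_assoc κ]
    exact add_le_add e1 (mul_le_mul_of_nonneg_left e3 hκ)
  · rw [abs_of_nonneg (add_nonneg e6 (mul_nonneg hκ e7))]
    exact add_le_add e5 (mul_le_mul_of_nonneg_left e4 hκ)
  · exact mul_volume_ball_le_setIntegral (H.measurableSet_starPolygon hm hN)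
      (H.starPolygon_subset_ball hm hN) (H.ball_subset_starPolygon hm hN) hw (hw0 _).le hv
  · exact mul_volume_ball_le_setIntegral (H.measurableSet_starDomain hm) hDM
      (ball_subset_starDomain fun θ _ => (half_le_self hm.le).trans (H.mem_Icc θ).1) hw
      (hw0 _).le hv

lemma isRadial_const {m M Λ : ℝ} (hmM : m ≤ M) (hΛ : 0 ≤ Λ) : IsRadial m M Λ fun _ => m :=
  ⟨contDiff_const, fun _ => rfl, fun _ => ⟨le_rfl, hmM⟩, fun θ => by simpa using hΛ⟩

/-- over the uniformly bounded, uniformly `C²` family `Θ` of radial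
functions, the infimum of the shape functional over the polygonal approximations
converges to the infimum over the smooth star-shaped domains at rate `1/N`. -/
theorem inf_shape_functional_polygon_approximation
    (lamlo lamhi Λ : ℝ) (h0 : 0 < lamlo) (h1 : lamlo ≤ lamhi) (hΛ : 0 < Λ)
    (Θ : Set (ℝ → ℝ))
    (hΘ : Θ = {r : ℝ → ℝ | ContDiff ℝ 2 r ∧ Function.Periodic r (2 * π) ∧
      (∀ θ, r θ ∈ Set.Icc lamlo lamhi) ∧
      ∀ θ, |deriv r θ| + |deriv (deriv r) θ| ≤ Λ})
    (V : EuclideanSpace ℝ (Fin 2) → ℝ) (hV : ContDiff ℝ 1 V)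
    (f : EuclideanSpace ℝ (Fin 2) → ℝ) (hf : Continuous f) (hf0 : ∀ x, 0 ≤ f x)
    (κ : ℝ) (hκ : 0 < κ) :
    ∃ C ≥ (0 : ℝ), ∀ N : ℕ, 4 ≤ N →
      |sInf ((fun r => shapeJ V f κ (starPolygon r N)) '' Θ) -
          sInf ((fun r => shapeJ V f κ (starDomain r)) '' Θ)| ≤ C / N := by
  obtain ⟨C, hC⟩ := exists_abs_shapeJ_sub_le h0 h1 hΛ.le hV hf hf0 hκ.le
  refine ⟨max C 0, le_max_right _ _, fun N hN => ?_⟩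
  have hbdd : ∀ E : (ℝ → ℝ) → Set Plane, BddBelow ((fun r => shapeJ V f κ (E r)) '' Θ) :=
    fun E => ⟨0, by
      rintro _ ⟨r, -, rfl⟩
      exact shapeJ_nonneg hf0 hκ.le _⟩
  have hne : Θ.Nonempty := by
    have H := isRadial_const h1 hΛ.le
    exact ⟨fun _ => lamlo, hΘ ▸ ⟨H.contDiff, H.periodic, H.mem_Icc, H.deriv_le⟩⟩
  refine abs_sInf_image_sub_le hne (hbdd fun r => starPolygon r N) (hbdd starDomain)
    fun r hr => ?_
  rw [hΘ] at hr
  obtain ⟨hr1, hr2, hr3, hr4⟩ := hr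
  refine (hC r ⟨hr1, hr2, hr3, hr4⟩ N hN).trans ?_
  rw [mul_one_div]
  gcongr
  exact le_max_left _ _
end

section
/- Let α > 0 and for i ∈ ℕ set a_i := 2^i, Ψ(x) := ((log x)/x)^α for x > 1, and b_i := a_i / Ψ(a_i). Then there exists a constant C > 0 such that for every n ≥ 2 and every real T with ∑_{i=1}^n (a_i + b_i) ≤ T ≤ ∑_{i=1}^{n+1} (a_i + b_i), it holds that (1/T) ( ∑_{i=1}^{n+1} a_i + ∑_{i=1}^{n+1} b_i Ψ(a_i) ) ≤ C ( (log T)/T )^{α/(α+1)}. -/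
open Real Finset

theorem div_le_log_div_rpow_of_le {α N T : ℝ} (hα : 0 < α) (hN : 1 < N) (hNT : N ≤ T)
    (h : N / (Real.log N / N) ^ α ≤ T) :
    N / T ≤ (Real.log T / T) ^ (α / (α + 1)) := by
  have hN0 : 0 < N := by linarith
  have hT : 0 < T := by linarith
  have hl : 0 < Real.log N := Real.log_pos hN
  have hlT : Real.log N ≤ Real.log T := Real.log_le_log hN0 hNT
  have hu : 0 < N / T := by positivity
  have h1 : N / T ≤ (Real.log N / N) ^ α := by
    rw [div_le_iff₀ (by positivity)] at h
    rw [div_le_iff₀ hT]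
    linarith
  have h2 : (N / T) ^ (α + 1) ≤ (Real.log T / T) ^ α := by
    calc (N / T) ^ (α + 1) = (N / T) ^ α * (N / T) := Real.rpow_add_one hu.ne' α
      _ ≤ (N / T) ^ α * (Real.log N / N) ^ α := by gcongr
      _ = (Real.log N / T) ^ α := by
        rw [← Real.mul_rpow hu.le (by positivity)]
        congr 1
        field_simp
      _ ≤ (Real.log T / T) ^ α := by gcongr
  have hLT : 0 ≤ Real.log T / T := div_nonneg (hl.le.trans hlT) hT.le
  rw [div_eq_mul_inv α, Real.rpow_mul hLT,
    Real.le_rpow_inv_iff_of_pos hu.le (by positivity) (by linarith)]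
  exact h2

/-- the arithmetic estimate behind the sublinear regret rate of the doubling
strategy: with exploration lengths `a_i = 2^i`, rate `Ψ(x) = ((log x)/x)^α` and
exploitation lengths `b_i = a_i/Ψ(a_i)`, the normalized regret bound is of order
`((log T)/T)^{α/(α+1)}`. -/
theorem doubling_strategy_regret_rate (α : ℝ) (hα : 0 < α)
    (a b : ℕ → ℝ) (Ψ : ℝ → ℝ)
    (ha : ∀ i, a i = 2 ^ i) (hΨ : ∀ x, Ψ x = (Real.log x / x) ^ α)
    (hb : ∀ i, b i = a i / Ψ (a i)) :
    ∃ C > (0 : ℝ), ∀ n : ℕ, 2 ≤ n → ∀ T : ℝ,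
      (∑ i ∈ Finset.Icc 1 n, (a i + b i)) ≤ T →
      T ≤ (∑ i ∈ Finset.Icc 1 (n + 1), (a i + b i)) →
      (1 / T) * ((∑ i ∈ Finset.Icc 1 (n + 1), a i) +
          ∑ i ∈ Finset.Icc 1 (n + 1), b i * Ψ (a i))
        ≤ C * (Real.log T / T) ^ (α / (α + 1)) := by
  have one_lt_a : ∀ i, 1 ≤ i → 1 < a i := fun i hi => by
    rw [ha]
    exact one_lt_pow₀ one_lt_two (by omega)
  have Ψ_pos : ∀ i, 1 ≤ i → 0 < Ψ (a i) := fun i hi => by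
    rw [hΨ]
    exact Real.rpow_pos_of_pos
      (div_pos (Real.log_pos (one_lt_a i hi)) (by linarith [one_lt_a i hi])) _
  have b_pos : ∀ i, 1 ≤ i → 0 < b i := fun i hi => by
    rw [hb]
    exact div_pos (by linarith [one_lt_a i hi]) (Ψ_pos i hi)
  have sum_a_le : ∀ m, ∑ i ∈ Finset.Icc 1 m, a i ≤ 2 * 2 ^ m := fun m => by
    induction m with
    | zero => simp
    | succ k ih =>
      rw [Finset.sum_Icc_succ_top (by omega), ha, pow_succ]
      linarith
  refine ⟨8, by norm_num, fun n hn T hT _ => ?_⟩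
  have hn1 : 1 ≤ n := by omega
  have hab : a n + b n ≤ T :=
    (Finset.single_le_sum (f := fun i => a i + b i)
      (fun i hi => by
        have hi1 := (Finset.mem_Icc.mp hi).1
        linarith [one_lt_a i hi1, b_pos i hi1])
      (Finset.mem_Icc.mpr ⟨hn1, le_rfl⟩)).trans hT
  have h1 := one_lt_a n hn1
  have h2 := b_pos n hn1
  have hT0 : 0 < T := by linarith
  have key : a n / T ≤ (Real.log T / T) ^ (α / (α + 1)) :=
    div_le_log_div_rpow_of_le hα h1 (by linarith) (by rw [← hΨ, ← hb]; linarith)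
  have hsum : ∑ i ∈ Finset.Icc 1 (n + 1), b i * Ψ (a i) = ∑ i ∈ Finset.Icc 1 (n + 1), a i :=
    Finset.sum_congr rfl fun i hi => by
      rw [hb, div_mul_cancel₀ _ (Ψ_pos i (Finset.mem_Icc.mp hi).1).ne']
  have hle := sum_a_le (n + 1)
  rw [pow_succ, ← ha] at hle
  rw [hsum]
  calc 1 / T * (∑ i ∈ Finset.Icc 1 (n + 1), a i + ∑ i ∈ Finset.Icc 1 (n + 1), a i)
      ≤ 1 / T * (8 * a n) := by
        gcongr
        linarith
    _ = 8 * (a n / T) := by ring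
    _ ≤ 8 * (Real.log T / T) ^ (α / (α + 1)) := by gcongr
end
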